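/- For every H, G ∈ ℋ there exist H̄, Ḡ ∈ ℋ̄ such that for all t ∈ [0,T] and all ω̄ = (ω,ν) ∈ Δ̄ one has (H̄·S̄)_t(ω̄) + (Ḡ·𝕊̄)_t(ω̄) = (H·S)_t(ω) + (G·𝕊)_t(ω). Conversely, for every H̄, Ḡ ∈ ℋ̄ there exist H, G ∈ ℋ such that for all t ∈ [0,T] and all ω ∈ Ω one has (H·S)_t(ω) + (G·𝕊)_t(ω) = (H̄·S̄)_t(ψ(ω)) + (Ḡ·𝕊̄)_t(ψ(ω)). -/

import Mathlib

open MeasureTheory Filter Set Topology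
open scoped ENNReal Classical

noncomputable section

namespace PathwiseSuperhedging

/-- The path space `C[0,T]`: continuous functions on `[0,T]` with the sup-norm. -/
abbrev Path (T : ℝ) := C(Set.Icc (0:ℝ) T, ℝ)

variable (T : ℝ)

instance : MeasurableSpace (Path T) := borel _
instance : BorelSpace (Path T) := ⟨rfl⟩

variable (hT : 0 ≤ T)

/-- time `0` as an element of `[0,T]`. -/
def t0 : Set.Icc (0:ℝ) T := ⟨0, le_refl 0, hT⟩

/-- clamp a real time into `[0,T]`. -/
def clamp (t : ℝ) : Set.Icc (0:ℝ) T := Set.projIcc 0 T hT t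

/-- evaluation of a path at a (clamped) real time. -/
def ev (ω : Path T) (t : ℝ) : ℝ := ω (clamp T hT t)

/-- The stopping times `σ^m_k`:  `σ^m_0 = 0` and
`σ^m_{k+1} = inf { t ≥ σ^m_k : |S_t - S_{σ^m_k}| ≥ 2^{-m} }` (equal to `T+1` if no such
time `t ≤ T` exists). -/
def sig (m : ℕ) : ℕ → Path T → ℝ
  | 0 => fun _ => 0
  | k + 1 => fun ω =>
      sInf ({t : ℝ | sig m k ω ≤ t ∧ t ≤ T ∧
        (2:ℝ) ^ (-(m:ℤ)) ≤ |ev T hT ω t - ev T hT ω (sig m k ω)|} ∪ {T + 1})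

/-- The discretized integral `𝕊^m_t = ∑_k S_{σ^m_k} (S_{σ^m_{k+1} ∧ t} - S_{σ^m_k ∧ t})`. -/
def Sm (m : ℕ) (t : ℝ) (ω : Path T) : ℝ :=
  ∑' k : ℕ, ev T hT ω (sig T hT m k ω) *
    (ev T hT ω (min (sig T hT m (k + 1) ω) t) - ev T hT ω (min (sig T hT m k ω) t))

/-- The pathwise integral `𝕊_t = liminf_m 𝕊^m_t`. -/
def SS (t : ℝ) (ω : Path T) : ℝ := Filter.liminf (fun m => Sm T hT m t ω) Filter.atTop

/-- The candidate quadratic variation `S_t² - S_0² - 2 𝕊_t`. -/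
def qvRaw (ω : Path T) (t : ℝ) : ℝ := (ev T hT ω t) ^ 2 - (ev T hT ω 0) ^ 2 - 2 * SS T hT t ω

/-- The set `Ω` of paths for which `𝕊^m → 𝕊` uniformly and
`t ↦ S_t² - S_0² - 2𝕊_t` is nondecreasing. -/
def BigOmega : Set (Path T) :=
  {ω | TendstoUniformly (fun m (t : Set.Icc (0:ℝ) T) => Sm T hT m (t : ℝ) ω)
        (fun t => SS T hT (t : ℝ) ω) Filter.atTop ∧
      MonotoneOn (qvRaw T hT ω) (Set.Icc (0:ℝ) T)}

/-- The pathwise quadratic variation `⟨ω⟩`, as an element of `C[0,T]`; it equals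
`S² - S_0² - 2𝕊` for `ω ∈ Ω` (this function being continuous there) and `0` otherwise. -/
def qv (ω : Path T) : Path T :=
  if h : ω ∈ BigOmega T hT ∧ Continuous fun t : Set.Icc (0:ℝ) T => qvRaw T hT ω (t : ℝ)
  then ⟨fun t => qvRaw T hT ω (t : ℝ), h.2⟩ else 0

/-- The raw filtration `F_t = σ(S_s : s ≤ t)` generated by the canonical process. -/
def Fraw (t : ℝ) : MeasurableSpace (Path T) :=
  ⨆ (s : Set.Icc (0:ℝ) T) (_ : (s : ℝ) ≤ t),
    MeasurableSpace.comap (fun ω : Path T => ω s) inferInstance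

/-- The right-continuous filtration `F_{t+} = ⋂_{s > t} F_{s ∧ T}`. -/
def Fplus (t : ℝ) : MeasurableSpace (Path T) :=
  ⨅ (s : ℝ) (_ : t < s), Fraw T (min s T)

/-- `τ` is a stopping time for the raw filtration `𝔽`. -/
def IsStopRaw (τ : Path T → ℝ) : Prop :=
  ∀ t ∈ Set.Icc (0:ℝ) T, MeasurableSet[Fraw T t] {ω | τ ω ≤ t}

/-- `τ` is a stopping time for the right-continuous filtration `𝔽₊`. -/
def IsStopPlus (τ : Path T → ℝ) : Prop :=
  ∀ t ∈ Set.Icc (0:ℝ) T, MeasurableSet[Fplus T t] {ω | τ ω ≤ t}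

/-- `f` is measurable with respect to the σ-field `F_{τ+}`. -/
def MeasAtStopPlus (τ f : Path T → ℝ) : Prop :=
  ∀ B : Set ℝ, MeasurableSet B → ∀ t ∈ Set.Icc (0:ℝ) T,
    MeasurableSet[Fplus T t] (f ⁻¹' B ∩ {ω | τ ω ≤ t})

/-- The set `ℋ` of simple trading strategies `H = ∑_{l=1}^L h_l 1_{(τ_l, τ_{l+1}]}`
with `𝔽₊`-stopping times `0 ≤ τ_1 ≤ ⋯ ≤ τ_{L+1} ≤ T` and bounded `F_{τ_l+}`-measurable
coefficients `h_l`. -/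
structure SimpleStrategy where
  L : ℕ
  τ : Fin (L + 1) → Path T → ℝ
  coeff : Fin L → Path T → ℝ
  τ_nonneg : ∀ ω, 0 ≤ τ 0 ω
  τ_mono : ∀ (l : Fin L) (ω), τ l.castSucc ω ≤ τ l.succ ω
  τ_le : ∀ ω, τ (Fin.last L) ω ≤ T
  τ_stop : ∀ l, IsStopPlus T (τ l)
  coeff_bdd : ∀ l, ∃ C : ℝ, ∀ ω, |coeff l ω| ≤ C
  coeff_meas : ∀ l : Fin L, MeasAtStopPlus T (τ l.castSucc) (coeff l)

/-- The pathwise stochastic integral `(H · X)_t(ω)` of a simple strategy against a process. -/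
def integ (H : SimpleStrategy T) (X : ℝ → Path T → ℝ) (t : ℝ) (ω : Path T) : ℝ :=
  ∑ l : Fin H.L, H.coeff l ω *
    (X (min (H.τ l.succ ω) t) ω - X (min (H.τ l.castSucc ω) t) ω)

/-- The canonical process `S_t(ω) = ω(t)`. -/
def Sproc (t : ℝ) (ω : Path T) : ℝ := ev T hT ω t

/-- `X` is a `Q`-`𝔽`-martingale (on the time interval `[0,T]`). -/
def IsMart (Q : Measure (Path T)) (X : ℝ → Path T → ℝ) : Prop :=
  (∀ t ∈ Set.Icc (0:ℝ) T, Integrable (X t) Q) ∧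
  ∀ s t : ℝ, s ∈ Set.Icc (0:ℝ) T → t ∈ Set.Icc (0:ℝ) T → s ≤ t →
    ∀ A : Set (Path T), MeasurableSet[Fraw T s] A →
      ∫ ω in A, X t ω ∂Q = ∫ ω in A, X s ω ∂Q

/-- `X` is a `Q`-`𝔽`-local martingale: there are `𝔽`-stopping times increasing `Q`-a.s.
to `∞` such that each stopped process is a `Q`-`𝔽`-martingale. -/
def IsLocalMart (Q : Measure (Path T)) (X : ℝ → Path T → ℝ) : Prop :=
  ∃ τ : ℕ → Path T → ℝ,
    (∀ m, IsStopRaw T (τ m)) ∧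
    (∀ᵐ ω ∂Q, Monotone (fun m => τ m ω) ∧ Tendsto (fun m => τ m ω) atTop atTop) ∧
    (∀ m, IsMart T Q (fun t ω => X (min (τ m ω) t) ω))

/-- The set `M(Ξ)` of local martingale measures concentrated on `Ξ`. -/
def MSet (Ξ : Set (Path T)) : Set (Measure (Path T)) :=
  {Q | IsProbabilityMeasure Q ∧ IsLocalMart T Q (Sproc T hT) ∧ Q Ξ = 1}

/-- The set `M_Z(Ξ)` of local martingale measures concentrated on `Ξ` with `E_Q[Z] < ∞`. -/
def MZSet (Ξ : Set (Path T)) (Z : Path T → ℝ≥0∞) : Set (Measure (Path T)) :=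
  {Q | IsProbabilityMeasure Q ∧ IsLocalMart T Q (Sproc T hT) ∧ Q Ξ = 1 ∧
       ∫⁻ ω, Z ω ∂Q ≠ ⊤}

/-- The stopped path `ω^t(s) = ω(t ∧ s)`. -/
def stopPath (ω : Path T) (t : Set.Icc (0:ℝ) T) : Path T :=
  ⟨fun s => ω ⟨min t.1 s.1, le_min t.2.1 s.2.1, (min_le_left _ _).trans t.2.2⟩,
    ω.continuous.comp ((continuous_const.min continuous_subtype_val).subtype_mk _)⟩

/-- Assumption A on the prediction set `Ξ` and its lift `Ξ̄`. -/
structure AssumptionA (Ξ : Set (Path T)) (Xibar : Set (Path T × Path T)) : Prop where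
  xi_nonempty : Ξ.Nonempty
  xibar_nonempty : Xibar.Nonempty
  xi_eq : Ξ = {ω ∈ BigOmega T hT | (ω, qv T hT ω) ∈ Xibar}
  A1 : ∃ K : ℕ → Set (Path T × Path T), (∀ n, IsCompact (K n)) ∧ Xibar = ⋃ n, K n
  A2 : ∀ p ∈ Xibar, p.2 (t0 T hT) = 0 ∧ Monotone p.2
  A3 : ∀ p ∈ Xibar, ∀ t : Set.Icc (0:ℝ) T, (stopPath T p.1 t, stopPath T p.2 t) ∈ Xibar

/-! ### The enlarged space -/

/-- The enlarged space `Ω̄ = C[0,T] × C[0,T]`. -/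
abbrev PathPair (T : ℝ) := Path T × Path T

/-- The embedding `ψ(ω) = (ω, ⟨ω⟩)`. -/
def psiMap (ω : Path T) : PathPair T := (ω, qv T hT ω)

/-- The diagonal set `Δ̄ = ψ(Ω)`. -/
def Delta : Set (PathPair T) := psiMap T hT '' BigOmega T hT

/-- The first canonical process `S̄_t(ω,ν) = ω(t)` on the enlarged space. -/
def SbarProc (t : ℝ) (p : PathPair T) : ℝ := ev T hT p.1 t

/-- The second canonical process `V̄_t(ω,ν) = ν(t)` on the enlarged space. -/
def VbarProc (t : ℝ) (p : PathPair T) : ℝ := ev T hT p.2 t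

/-- The process `𝕊̄ = (S̄² - S̄_0² - V̄)/2` on the enlarged space. -/
def SSbarProc (t : ℝ) (p : PathPair T) : ℝ :=
  ((ev T hT p.1 t) ^ 2 - (ev T hT p.1 0) ^ 2 - ev T hT p.2 t) / 2

/-- The raw filtration `F̄_t = σ(S̄_s, V̄_s : s ≤ t)` on the enlarged space. -/
def FbarRaw (t : ℝ) : MeasurableSpace (PathPair T) :=
  ⨆ (s : Set.Icc (0:ℝ) T) (_ : (s : ℝ) ≤ t),
    MeasurableSpace.comap (fun p : PathPair T => (p.1 s, p.2 s)) inferInstance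

/-- The right-continuous filtration `F̄_{t+} = ⋂_{s>t} F̄_{s ∧ T}` on the enlarged space. -/
def FbarPlus (t : ℝ) : MeasurableSpace (PathPair T) :=
  ⨅ (s : ℝ) (_ : t < s), FbarRaw T (min s T)

/-- The σ-field generated by all subsets of `Δ̄ᶜ`. -/
def nullDelta : MeasurableSpace (PathPair T) :=
  MeasurableSpace.generateFrom {N : Set (PathPair T) | N ⊆ (Delta T hT)ᶜ}

/-- The `Δ̄`-augmented raw filtration `F̄^Δ_t`. -/
def FbarDelta (t : ℝ) : MeasurableSpace (PathPair T) := FbarRaw T t ⊔ nullDelta T hT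

/-- The `Δ̄`-augmented right-continuous filtration `F̄^Δ_{t+}`. -/
def FbarDeltaPlus (t : ℝ) : MeasurableSpace (PathPair T) := FbarPlus T t ⊔ nullDelta T hT

/-- `τ` is a stopping time for the raw filtration `𝔽̄` on the enlarged space. -/
def IsStopBarRaw (τ : PathPair T → ℝ) : Prop :=
  ∀ t ∈ Set.Icc (0:ℝ) T, MeasurableSet[FbarRaw T t] {p | τ p ≤ t}

/-- `τ` is a stopping time for the filtration `𝔽̄₊^Δ`. -/
def IsStopBarDeltaPlus (τ : PathPair T → ℝ) : Prop :=
  ∀ t ∈ Set.Icc (0:ℝ) T, MeasurableSet[FbarDeltaPlus T hT t] {p | τ p ≤ t}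

/-- `f` is measurable with respect to `F̄^Δ_{τ+}`. -/
def MeasAtStopBarDeltaPlus (τ f : PathPair T → ℝ) : Prop :=
  ∀ B : Set ℝ, MeasurableSet B → ∀ t ∈ Set.Icc (0:ℝ) T,
    MeasurableSet[FbarDeltaPlus T hT t] (f ⁻¹' B ∩ {p | τ p ≤ t})

/-- The set `ℋ̄` of simple strategies on the enlarged space. -/
structure SimpleStrategyBar where
  L : ℕ
  τ : Fin (L + 1) → PathPair T → ℝ
  coeff : Fin L → PathPair T → ℝ
  τ_nonneg : ∀ p, 0 ≤ τ 0 p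
  τ_mono : ∀ (l : Fin L) (p), τ l.castSucc p ≤ τ l.succ p
  τ_le : ∀ p, τ (Fin.last L) p ≤ T
  τ_stop : ∀ l, IsStopBarDeltaPlus T hT (τ l)
  coeff_bdd : ∀ l, ∃ C : ℝ, ∀ p, |coeff l p| ≤ C
  coeff_meas : ∀ l : Fin L, MeasAtStopBarDeltaPlus T hT (τ l.castSucc) (coeff l)

/-- The pathwise stochastic integral on the enlarged space. -/
def integBar (H : SimpleStrategyBar T hT) (X : ℝ → PathPair T → ℝ) (t : ℝ)
    (p : PathPair T) : ℝ :=
  ∑ l : Fin H.L, H.coeff l p *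
    (X (min (H.τ l.succ p) t) p - X (min (H.τ l.castSucc p) t) p)

/-- `X` is a `Q̄`-`𝔽̄`-martingale on the enlarged space. -/
def IsMartBar (Q : Measure (PathPair T)) (X : ℝ → PathPair T → ℝ) : Prop :=
  (∀ t ∈ Set.Icc (0:ℝ) T, Integrable (X t) Q) ∧
  ∀ s t : ℝ, s ∈ Set.Icc (0:ℝ) T → t ∈ Set.Icc (0:ℝ) T → s ≤ t →
    ∀ A : Set (PathPair T), MeasurableSet[FbarRaw T s] A →
      ∫ p in A, X t p ∂Q = ∫ p in A, X s p ∂Q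

/-- `X` is a `Q̄`-`𝔽̄`-local martingale on the enlarged space. -/
def IsLocalMartBar (Q : Measure (PathPair T)) (X : ℝ → PathPair T → ℝ) : Prop :=
  ∃ τ : ℕ → PathPair T → ℝ,
    (∀ m, IsStopBarRaw T (τ m)) ∧
    (∀ᵐ p ∂Q, Monotone (fun m => τ m p) ∧ Tendsto (fun m => τ m p) atTop atTop) ∧
    (∀ m, IsMartBar T Q (fun t p => X (min (τ m p) t) p))

/-- The set `M̄(Ξ̄)` of measures on the enlarged space under which `S̄` and `𝕊̄` are local
martingales and which are concentrated on `Ξ̄`. -/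
def MbarSet (Xibar : Set (PathPair T)) : Set (Measure (PathPair T)) :=
  {Q | IsProbabilityMeasure Q ∧ IsLocalMartBar T Q (SbarProc T hT) ∧
       IsLocalMartBar T Q (SSbarProc T hT) ∧ Q Xibar = 1}

/-- The set `M̄_{Z̄}(Ξ̄)`. -/
def MbarZSet (Xibar : Set (PathPair T)) (Zbar : PathPair T → ℝ≥0∞) :
    Set (Measure (PathPair T)) :=
  {Q | IsProbabilityMeasure Q ∧ IsLocalMartBar T Q (SbarProc T hT) ∧
       IsLocalMartBar T Q (SSbarProc T hT) ∧ Q Xibar = 1 ∧ ∫⁻ p, Zbar p ∂Q ≠ ⊤}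

/-! ### Expectations and superhedging functionals -/

/-- The positive part of an extended real number, as an element of `[0,∞]`. -/
def erealPos (x : EReal) : ℝ≥0∞ := if x = ⊤ then ⊤ else ENNReal.ofReal x.toReal

/-- The expectation `E_Q[ξ]` of an extended-real-valued random variable, as an
extended real number (positive part minus negative part). -/
def expEReal {α : Type*} [MeasurableSpace α] (Q : Measure α) (ξ : α → EReal) : EReal :=
  ((∫⁻ x, erealPos (ξ x) ∂Q : ℝ≥0∞) : EReal) - ((∫⁻ x, erealPos (-ξ x) ∂Q : ℝ≥0∞) : EReal)

/-- The set of initial capitals `λ` that allow superhedging `ξ` on `Ξ`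
(trading in `S` and `𝕊` with simple strategies, in the liminf sense). -/
def PhiSet (Ξ : Set (Path T)) (ξ : Path T → EReal) : Set ℝ :=
  {lam : ℝ | ∃ H G : ℕ → SimpleStrategy T,
    (∀ n : ℕ, ∀ t ∈ Set.Icc (0:ℝ) T, ∀ ω ∈ Ξ,
      0 ≤ lam + integ T (H n) (Sproc T hT) t ω + integ T (G n) (SS T hT) t ω) ∧
    (∀ ω ∈ Ξ, ξ ω ≤ (lam : EReal) +
      Filter.liminf (fun n =>
        ((integ T (H n) (Sproc T hT) T ω + integ T (G n) (SS T hT) T ω : ℝ) : EReal))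
        Filter.atTop)}

/-- The superhedging price `Φ(ξ)`. -/
def Phi (Ξ : Set (Path T)) (ξ : Path T → EReal) : EReal :=
  sInf ((fun lam : ℝ => (lam : EReal)) '' PhiSet T hT Ξ ξ)

/-- The supremum of the pricing functionals `E_Q[ξ]` over `Q ∈ M(Ξ)`,
for a nonnegative claim `ξ`. -/
def supMart (Ξ : Set (Path T)) (ξ : Path T → ℝ≥0∞) : ℝ≥0∞ :=
  ⨆ Q ∈ MSet T hT Ξ, ∫⁻ ω, ξ ω ∂Q

/-- The liminf-closure `𝒢^Ξ_λ`: the smallest set of functions `C[0,T] → [-∞,∞]`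
containing `λ + (H·S)_T` for admissible simple `H` and closed under countable liminf. -/
inductive GG (Ξ : Set (Path T)) (lam : ℝ) : (Path T → EReal) → Prop
  | base (H : SimpleStrategy T)
      (hadm : ∀ t ∈ Set.Icc (0:ℝ) T, ∀ ω ∈ Ξ, 0 ≤ lam + integ T H (Sproc T hT) t ω) :
      GG Ξ lam (fun ω => ((lam + integ T H (Sproc T hT) T ω : ℝ) : EReal))
  | lim (X : ℕ → Path T → EReal) (h : ∀ n, GG Ξ lam (X n)) :
      GG Ξ lam (fun ω => Filter.liminf (fun n => X n ω) Filter.atTop)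

/-- The superhedging price `Φ^cl(ξ)` defined via the liminf-closure. -/
def PhiCl (Ξ : Set (Path T)) (ξ : Path T → EReal) : EReal :=
  sInf {x : EReal | ∃ lam : ℝ, x = (lam : EReal) ∧
    ∃ Y : Path T → EReal, GG T hT Ξ lam Y ∧ ∀ ω ∈ Ξ, ξ ω ≤ Y ω}


/-- The set of initial capitals allowing superhedging on the enlarged space
(superhedging on `Δ̄ ∩ Ξ̄`). -/
def PhiBarSet (Xibar : Set (PathPair T)) (ξ : PathPair T → EReal) : Set ℝ :=
  {lam : ℝ | ∃ H G : ℕ → SimpleStrategyBar T hT,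
    (∀ n : ℕ, ∀ t ∈ Set.Icc (0:ℝ) T, ∀ p ∈ Delta T hT ∩ Xibar,
      0 ≤ lam + integBar T hT (H n) (SbarProc T hT) t p
            + integBar T hT (G n) (SSbarProc T hT) t p) ∧
    (∀ p ∈ Delta T hT ∩ Xibar, ξ p ≤ (lam : EReal) +
      Filter.liminf (fun n =>
        ((integBar T hT (H n) (SbarProc T hT) T p
          + integBar T hT (G n) (SSbarProc T hT) T p : ℝ) : EReal)) Filter.atTop)}

/-- The superhedging price `Φ̄(ξ̄)` on the enlarged space. -/
def PhiBar (Xibar : Set (PathPair T)) (ξ : PathPair T → EReal) : EReal :=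
  sInf ((fun lam : ℝ => (lam : EReal)) '' PhiBarSet T hT Xibar ξ)

/-- The supremum of pricing functionals over `M̄(Ξ̄)` for a nonnegative claim. -/
def supMartBar (Xibar : Set (PathPair T)) (ξ : PathPair T → ℝ≥0∞) : ℝ≥0∞ :=
  ⨆ Q ∈ MbarSet T hT Xibar, ∫⁻ p, ξ p ∂Q

/-- Assumption B on the prediction set `Ξ`, determined by a growth function `Z̄`
(with values in `[1,∞]`). -/
structure AssumptionB (Ξ : Set (Path T)) (Zbar : PathPair T → ℝ≥0∞) : Prop where
  xi_nonempty : Ξ.Nonempty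
  one_le : ∀ p, 1 ≤ Zbar p
  xi_eq : Ξ = {ω ∈ BigOmega T hT | Zbar (ω, qv T hT ω) ≠ ⊤}
  B1 : ∀ c : ℝ≥0∞, c ≠ ⊤ → IsCompact {p : PathPair T | Zbar p ≤ c}
  B2 : ∀ p : PathPair T, Zbar p ≠ ⊤ → p.2 (t0 T hT) = 0 ∧ Monotone p.2
  B3 : ∀ p : PathPair T, ENNReal.ofReal (‖p.1‖ + ‖p.2‖) ≤ Zbar p

/-- The set of initial capitals allowing `Z`-admissible superhedging of `ξ` on `Ξ`. -/
def PhiZSet (Ξ : Set (Path T)) (Z : Path T → ℝ≥0∞) (ξ : Path T → EReal) : Set ℝ :=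
  {lam : ℝ | ∃ c : ℝ, 0 ≤ c ∧ ∃ H G : ℕ → SimpleStrategy T,
    (∀ n : ℕ, ∀ ω ∈ Ξ,
      -(c * (Z ω).toReal) ≤
        lam + integ T (H n) (Sproc T hT) T ω + integ T (G n) (SS T hT) T ω) ∧
    (∀ ω ∈ Ξ, ξ ω ≤ (lam : EReal) +
      Filter.liminf (fun n =>
        ((integ T (H n) (Sproc T hT) T ω + integ T (G n) (SS T hT) T ω : ℝ) : EReal))
        Filter.atTop)}

/-- The superhedging price `Φ^Z(ξ)`. -/
def PhiZ (Ξ : Set (Path T)) (Z : Path T → ℝ≥0∞) (ξ : Path T → EReal) : EReal :=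
  sInf ((fun lam : ℝ => (lam : EReal)) '' PhiZSet T hT Ξ Z ξ)

/-- The `α`-Hölder norm `‖ω‖_α = |ω(0)| + sup_{s ≠ t} |ω(t) - ω(s)| / |t-s|^α`,
with values in `[0,∞]`. -/
def holderNormE (α : ℝ) (ω : Path T) : ℝ≥0∞ :=
  ENNReal.ofReal |ω (t0 T hT)| +
    ⨆ (s : Set.Icc (0:ℝ) T) (t : Set.Icc (0:ℝ) T) (_ : s ≠ t),
      ENNReal.ofReal (|ω t - ω s| / |t.1 - s.1| ^ α)

/-- The set of Hölder continuous paths `⋃_n { ω : ‖ω‖_{1/n} ≤ n }`. -/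
def CHolder : Set (Path T) :=
  ⋃ n : ℕ, {ω : Path T | 0 < n ∧ holderNormE T hT (1 / n) ω ≤ (n : ℝ≥0∞)}

end PathwiseSuperhedging

namespace PathwiseSuperhedging

section aux
variable {T : ℝ} (hT : 0 ≤ T)

lemma ev_cont (ω : Path T) : Continuous (fun t => ev T hT ω t) :=
  ω.continuous.comp (continuous_projIcc (h := hT))

lemma sig_le (m k : ℕ) (ω : Path T) : sig T hT m k ω ≤ T + 1 := by
  cases k with
  | zero => simp only [sig]; linarith
  | succ k =>
    simp only [sig]
    refine csInf_le ⟨min (sig T hT m k ω) (T+1), ?_⟩ (Or.inr rfl)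
    rintro x (hx | hx)
    · exact (min_le_left _ _).trans hx.1
    · exact (min_le_right _ _).trans (le_of_eq hx.symm)

lemma sig_mono (m k : ℕ) (ω : Path T) : sig T hT m k ω ≤ sig T hT m (k+1) ω := by
  conv_rhs => simp only [sig]
  refine le_csInf ⟨T+1, Or.inr rfl⟩ ?_
  rintro x (hx | hx)
  · exact hx.1
  · rw [hx]; exact sig_le hT m k ω

lemma sig_nonneg (m k : ℕ) (ω : Path T) : 0 ≤ sig T hT m k ω := by
  induction k with
  | zero => simp [sig]
  | succ k ih => exact ih.trans (sig_mono hT m k ω)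

lemma sig_mem (m k : ℕ) (ω : Path T) (h : sig T hT m (k+1) ω ≤ T) :
    (2:ℝ) ^ (-(m:ℤ)) ≤ |ev T hT ω (sig T hT m (k+1) ω) - ev T hT ω (sig T hT m k ω)| := by
  have hc : IsClosed ({t : ℝ | sig T hT m k ω ≤ t ∧ t ≤ T ∧
        (2:ℝ) ^ (-(m:ℤ)) ≤ |ev T hT ω t - ev T hT ω (sig T hT m k ω)|} ∪ {T + 1}) := by
    refine IsClosed.union ?_ isClosed_singleton
    refine (isClosed_le continuous_const continuous_id).inter
      ((isClosed_le continuous_id continuous_const).inter ?_)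
    exact isClosed_le continuous_const (((ev_cont hT ω).sub continuous_const).abs)
  have hm := hc.csInf_mem ⟨T+1, Or.inr rfl⟩ (by
    refine ⟨sig T hT m k ω, ?_⟩
    rintro x (hx | hx)
    · exact hx.1
    · rw [hx]; exact sig_le hT m k ω)
  have e : sInf ({t : ℝ | sig T hT m k ω ≤ t ∧ t ≤ T ∧
        (2:ℝ) ^ (-(m:ℤ)) ≤ |ev T hT ω t - ev T hT ω (sig T hT m k ω)|} ∪ {T + 1})
      = sig T hT m (k+1) ω := by simp only [sig]
  rw [e] at hm
  rcases hm with hm | hm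
  · exact hm.2.2
  · rw [mem_singleton_iff] at hm; linarith

lemma sig_succ_le_iff (m k : ℕ) (ω : Path T) (c : ℝ) (hc : c ≤ T) :
    sig T hT m (k+1) ω ≤ c ↔ ∃ u, sig T hT m k ω ≤ u ∧ u ≤ c ∧
      (2:ℝ) ^ (-(m:ℤ)) ≤ |ev T hT ω u - ev T hT ω (sig T hT m k ω)| := by
  constructor
  · intro h
    exact ⟨_, sig_mono hT m k ω, h, sig_mem hT m k ω (h.trans hc)⟩
  · rintro ⟨u, h1, h2, h3⟩
    refine le_trans ?_ h2
    simp only [sig]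
    refine csInf_le ⟨sig T hT m k ω, ?_⟩ (Or.inl ⟨h1, h2.trans hc, h3⟩)
    rintro x (hx | hx)
    · exact hx.1
    · rw [hx]; exact sig_le hT m k ω

lemma sig_eventually (m : ℕ) (ω : Path T) : ∃ K, ∀ k, K ≤ k → T < sig T hT m k ω := by
  have hmono : Monotone (fun k => sig T hT m k ω) := monotone_nat_of_le_succ (sig_mono hT m · ω)
  by_contra! hcon
  have hle : ∀ k, sig T hT m k ω ≤ T := by
    intro k
    obtain ⟨j, hj, h⟩ := hcon k
    exact (hmono hj).trans h
  obtain ⟨l, hl⟩ : ∃ l, Tendsto (fun k => sig T hT m k ω) atTop (𝓝 l) :=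
    ⟨_, tendsto_atTop_ciSup hmono ⟨T, by rintro _ ⟨k, rfl⟩; exact hle k⟩⟩
  have h1 := ((ev_cont hT ω).tendsto l).comp hl
  have h2 := ((h1.comp (tendsto_add_atTop_nat 1)).sub h1).abs
  have h3 := ge_of_tendsto' h2 (fun k => sig_mem hT m k ω (hle (k+1)))
  simp only [sub_self, abs_zero] at h3
  have : (0:ℝ) < 2 ^ (-(m:ℤ)) := by positivity
  linarith

lemma Sm_term_zero (m k : ℕ) (t : ℝ) (ω : Path T) (h : t ≤ sig T hT m k ω) :
    ev T hT ω (min (sig T hT m (k + 1) ω) t) - ev T hT ω (min (sig T hT m k ω) t) = 0 := by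
  rw [min_eq_right h, min_eq_right (h.trans (sig_mono hT m k ω)), sub_self]

lemma Sm_eq_sum (m : ℕ) (ω : Path T) : ∃ K, ∀ N, K ≤ N → ∀ t, t ≤ T → Sm T hT m t ω =
    ∑ k ∈ Finset.range N, ev T hT ω (sig T hT m k ω) *
    (ev T hT ω (min (sig T hT m (k + 1) ω) t) - ev T hT ω (min (sig T hT m k ω) t)) := by
  obtain ⟨K, hK⟩ := sig_eventually hT m ω
  refine ⟨K, fun N hN t ht => tsum_eq_sum ?_⟩
  intro k hk
  rw [Finset.mem_range, not_lt] at hk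
  rw [Sm_term_zero hT m k t ω (ht.trans (hK k (hN.trans hk)).le), mul_zero]

lemma Sm_cont (m : ℕ) (ω : Path T) : Continuous (fun t : Set.Icc (0:ℝ) T => Sm T hT m (t:ℝ) ω) := by
  obtain ⟨K, hK⟩ := Sm_eq_sum hT m ω
  have : (fun t : Set.Icc (0:ℝ) T => Sm T hT m (t:ℝ) ω) = fun t : Set.Icc (0:ℝ) T =>
      ∑ k ∈ Finset.range K, ev T hT ω (sig T hT m k ω) *
    (ev T hT ω (min (sig T hT m (k + 1) ω) t) - ev T hT ω (min (sig T hT m k ω) t)) := by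
    ext t; exact hK K le_rfl t t.2.2
  rw [this]
  refine continuous_finsetSum _ fun k _ => continuous_const.mul ?_
  exact ((ev_cont hT ω).comp (continuous_const.min continuous_subtype_val)).sub
    ((ev_cont hT ω).comp (continuous_const.min continuous_subtype_val))

lemma clamp_of_mem {t : ℝ} (ht : t ∈ Set.Icc (0:ℝ) T) : clamp T hT t = ⟨t, ht⟩ :=
  Set.projIcc_of_mem hT ht

lemma qv_apply {ω : Path T} (hω : ω ∈ BigOmega T hT) (t : Set.Icc (0:ℝ) T) :
    qv T hT ω t = qvRaw T hT ω t := by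
  have hc : Continuous fun t : Set.Icc (0:ℝ) T => qvRaw T hT ω (t : ℝ) := by
    have h1 : Continuous fun t : Set.Icc (0:ℝ) T => SS T hT (t:ℝ) ω :=
      hω.1.continuous (Frequently.of_forall fun m => Sm_cont hT m ω)
    have h2 : Continuous fun t : Set.Icc (0:ℝ) T => ev T hT ω (t:ℝ) :=
      (ev_cont hT ω).comp continuous_subtype_val
    exact ((h2.pow 2).sub continuous_const).sub (continuous_const.mul h1)
  have : ω ∈ BigOmega T hT ∧ Continuous fun t : Set.Icc (0:ℝ) T => qvRaw T hT ω (t : ℝ) := ⟨hω, hc⟩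
  simp only [qv, dif_pos this]
  rfl

lemma SSbar_psi {ω : Path T} (hω : ω ∈ BigOmega T hT) {t : ℝ} (ht : t ∈ Set.Icc (0:ℝ) T) :
    SSbarProc T hT t (psiMap T hT ω) = SS T hT t ω := by
  simp only [SSbarProc, psiMap]
  have : ev T hT (qv T hT ω) t = qvRaw T hT ω t := by
    rw [ev, clamp_of_mem hT ht, qv_apply hT hω]
  rw [this, qvRaw]; ring

/-! measurability -/
lemma Fraw_mono {s t : ℝ} (h : s ≤ t) : Fraw T s ≤ Fraw T t :=
  iSup_mono fun _ => iSup_le fun hu => le_iSup_of_le (hu.trans h) le_rfl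

lemma eval_meas {t : ℝ} (s : Set.Icc (0:ℝ) T) (h : (s:ℝ) ≤ t) :
    Measurable[Fraw T t] (fun ω : Path T => ω s) := by
  have : MeasurableSpace.comap (fun ω : Path T => ω s) inferInstance ≤ Fraw T t :=
    le_iSup_of_le s (le_iSup_of_le h le_rfl)
  exact measurable_iff_comap_le.2 this

lemma ev_meas {t : ℝ} (ht : 0 ≤ t) (s : ℝ) (h : s ≤ t) :
    Measurable[Fraw T t] (fun ω : Path T => ev T hT ω s) := by
  refine eval_meas _ ?_
  simp only [clamp, coe_projIcc]
  exact max_le ht ((min_le_right _ _).trans h)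

lemma meas_countable {α : Type*} {m : MeasurableSpace α} (f : ℕ → α → ℝ)
    (hf : ∀ k, Measurable (f k)) (N : α → ℕ) (hN : Measurable N) :
    Measurable (fun a => f (N a) a) := by
  have hg : Measurable (fun p : α × ℕ => f p.2 p.1) :=
    measurable_from_prod_countable_left (fun k => hf k)
  exact hg.comp (measurable_id.prodMk hN)

lemma ev_meas_comp {t : ℝ} (ht : 0 ≤ t) (U : Path T → ℝ) (hU : Measurable[Fraw T t] U)
    (h0 : ∀ ω, 0 ≤ U ω) (h : ∀ ω, U ω ≤ t) :
    Measurable[Fraw T t] (fun ω : Path T => ev T hT ω (U ω)) := by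
  have hn : ∀ n : ℕ, Measurable[Fraw T t]
      (fun ω : Path T => ev T hT ω (min t ((⌊((n:ℝ)+1) * U ω⌋₊ : ℝ) / ((n:ℝ)+1)))) := by
    intro n
    have hf : Measurable[Fraw T t] (fun ω : Path T => ⌊((n:ℝ)+1) * U ω⌋₊) :=
      Nat.measurable_floor.comp (hU.const_mul _)
    exact meas_countable (fun k ω => ev T hT ω (min t ((k : ℝ) / ((n:ℝ)+1))))
      (fun k => ev_meas hT ht _ (min_le_left _ _)) _ hf
  refine @measurable_of_tendsto_metrizable _ _ (Fraw T t) _ _ _ _ _ _ hn ?_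
  rw [tendsto_pi_nhds]
  intro ω
  refine ((ev_cont hT ω).tendsto _).comp ?_
  have hc : Tendsto (fun n : ℕ => (n:ℝ)+1) atTop atTop :=
    tendsto_atTop_add_const_right _ _ tendsto_natCast_atTop_atTop
  have h2 := (tendsto_nat_floor_mul_div_atTop (h0 ω)).comp hc
  have h3 := (tendsto_const_nhds (x := t)).min h2
  rw [min_eq_right (h ω)] at h3
  refine h3.congr fun n => ?_
  simp only [Function.comp, mul_comm]

lemma min_meas {t : ℝ} (ht : t ≤ T) (U : Path T → ℝ) (h0 : ∀ ω, 0 ≤ U ω)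
    (hU : ∀ c ∈ Set.Icc (0:ℝ) T, MeasurableSet[Fraw T c] {ω | U ω ≤ c}) :
    Measurable[Fraw T t] (fun ω => min (U ω) t) := by
  refine measurable_of_Iic fun c => ?_
  by_cases hc : t ≤ c
  · convert @MeasurableSet.univ _ (Fraw T t)
    ext ω; simp [hc]
  · push Not at hc
    by_cases h : 0 ≤ c
    · have := Fraw_mono hc.le _ (hU c ⟨h, hc.le.trans ht⟩)
      convert this using 1
      ext ω; simp [not_le.2 hc]
    · convert @MeasurableSet.empty _ (Fraw T t)
      ext ω
      simp only [mem_preimage, mem_Iic, mem_empty_iff_false, iff_false, min_le_iff, not_or, not_le]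
      exact ⟨(not_le.1 h).trans_le (h0 ω), hc⟩

lemma sig_key (m k : ℕ) (ω : Path T) (c : ℝ) (hc : c ≤ T) :
    sig T hT m (k+1) ω ≤ c ↔ sig T hT m k ω ≤ c ∧ ∀ n : ℕ, ∃ i : ℕ,
      (2:ℝ) ^ (-(m:ℤ)) - 1 / ((n:ℝ)+1) <
      |ev T hT ω (min (sig T hT m k ω) c +
        (TopologicalSpace.denseSeq unitInterval i : ℝ) * (c - min (sig T hT m k ω) c))
        - ev T hT ω (min (sig T hT m k ω) c)| := by
  rw [sig_succ_le_iff hT m k ω c hc]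
  set a := sig T hT m k ω
  set φ : unitInterval → ℝ := fun r => |ev T hT ω (min a c + (r:ℝ) * (c - min a c))
        - ev T hT ω (min a c)| with hφ
  have hφc : Continuous φ := by
    refine (((ev_cont hT ω).comp ?_).sub continuous_const).abs
    fun_prop
  constructor
  · rintro ⟨u, h1, h2, h3⟩
    have hac := h1.trans h2
    refine ⟨hac, fun n => ?_⟩
    have hex : ∃ r : unitInterval, a + (r:ℝ) * (c - a) = u := by
      rcases hac.eq_or_lt with h | h
      · exact ⟨0, by simp; linarith⟩
      · refine ⟨⟨(u - a) / (c - a), div_nonneg (by linarith) (by linarith),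
          (div_le_one (by linarith)).2 (by linarith)⟩, ?_⟩
        have : c - a ≠ 0 := by linarith
        field_simp; ring
    obtain ⟨r, hr⟩ := hex
    have hpos : (0:ℝ) < 1 / ((n:ℝ)+1) := by positivity
    obtain ⟨i, hi⟩ := (TopologicalSpace.denseRange_denseSeq unitInterval).exists_mem_open
      (isOpen_lt (continuous_const (y := (2:ℝ) ^ (-(m:ℤ)) - 1 / ((n:ℝ)+1))) hφc) ⟨r, by
        simp only [mem_ofPred_eq, hφ, min_eq_left hac, hr]; linarith⟩
    exact ⟨i, hi⟩
  · rintro ⟨hac, h⟩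
    obtain ⟨r, -, hr⟩ := isCompact_univ.exists_isMaxOn (univ_nonempty) hφc.continuousOn
    refine ⟨a + (r:ℝ) * (c - a), ?_, ?_, ?_⟩
    · have := mul_nonneg r.2.1 (sub_nonneg.2 hac); linarith
    · have := mul_le_mul_of_nonneg_right r.2.2 (sub_nonneg.2 hac); linarith
    · have hlim : Tendsto (fun n : ℕ => (2:ℝ) ^ (-(m:ℤ)) - 1 / ((n:ℝ)+1)) atTop
          (𝓝 ((2:ℝ) ^ (-(m:ℤ)) - 0)) := tendsto_const_nhds.sub tendsto_one_div_add_atTop_nhds_zero_nat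
      rw [sub_zero] at hlim
      have := le_of_tendsto' hlim (fun n => by
        obtain ⟨i, hi⟩ := h n
        exact hi.le.trans (hr (mem_univ (TopologicalSpace.denseSeq unitInterval i))))
      simpa only [hφ, min_eq_left hac] using this

lemma sig_stop (m k : ℕ) : ∀ c ∈ Set.Icc (0:ℝ) T,
    MeasurableSet[Fraw T c] {ω | sig T hT m k ω ≤ c} := by
  induction k with
  | zero =>
    intro c hc
    simp only [sig, hc.1, ofPred_true]
    exact @MeasurableSet.univ _ (Fraw T c)
  | succ k ih =>
    intro c hc
    have ha := min_meas hc.2 _ (sig_nonneg hT m k) ih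
    have e : {ω | sig T hT m (k+1) ω ≤ c} = {ω | sig T hT m k ω ≤ c} ∩ ⋂ n : ℕ, ⋃ i : ℕ,
      {ω | (2:ℝ) ^ (-(m:ℤ)) - 1 / ((n:ℝ)+1) <
      |ev T hT ω (min (sig T hT m k ω) c +
        (TopologicalSpace.denseSeq unitInterval i : ℝ) * (c - min (sig T hT m k ω) c))
        - ev T hT ω (min (sig T hT m k ω) c)|} := by
      ext ω
      simp only [mem_inter_iff, mem_iInter, mem_iUnion]
      exact sig_key hT m k ω c hc.2
    rw [e]
    refine @MeasurableSet.inter _ (Fraw T c) _ _ (ih c hc) ?_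
    refine @MeasurableSet.iInter _ _ (Fraw T c) _ _ fun n => 
      @MeasurableSet.iUnion _ _ (Fraw T c) _ _ fun i => ?_
    refine measurableSet_lt (@measurable_const _ _ _ (Fraw T c) _) ?_
    have hr := (TopologicalSpace.denseSeq unitInterval i).2
    refine _root_.continuous_abs.measurable.comp
      (Measurable.sub (ev_meas_comp hT hc.1 _ ?_ ?_ ?_) (ev_meas_comp hT hc.1 _ ha ?_ ?_))
    · exact ha.add ((@measurable_const _ _ _ (Fraw T c) c).sub ha |>.const_mul _)
    · intro ω
      have h1 := le_min (sig_nonneg hT m k ω) hc.1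
      have h2 := mul_nonneg hr.1 (sub_nonneg.2 (min_le_right (sig T hT m k ω) c))
      linarith
    · intro ω
      have h2 := mul_le_mul_of_nonneg_right hr.2 (sub_nonneg.2 (min_le_right (sig T hT m k ω) c))
      linarith
    · exact fun ω => le_min (sig_nonneg hT m k ω) hc.1
    · exact fun ω => min_le_right _ _

lemma Sm_meas (m : ℕ) {t : ℝ} (ht : t ∈ Set.Icc (0:ℝ) T) :
    Measurable[Fraw T t] (fun ω : Path T => Sm T hT m t ω) := by
  have h1 : ∀ k, Measurable[Fraw T t] (fun ω : Path T => ev T hT ω (min (sig T hT m k ω) t)) :=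
    fun k => ev_meas_comp hT ht.1 _ (min_meas ht.2 _ (sig_nonneg hT m k) (sig_stop hT m k))
      (fun ω => le_min (sig_nonneg hT m k ω) ht.1) (fun ω => min_le_right _ _)
  have hN : ∀ N : ℕ, Measurable[Fraw T t] (fun ω : Path T => ∑ k ∈ Finset.range N,
      ev T hT ω (min (sig T hT m k ω) t) *
      (ev T hT ω (min (sig T hT m (k + 1) ω) t) - ev T hT ω (min (sig T hT m k ω) t))) :=
    fun N => Finset.measurable_fun_sum _ fun k _ => (h1 k).mul ((h1 (k+1)).sub (h1 k))
  refine @measurable_of_tendsto_metrizable _ _ (Fraw T t) _ _ _ _ _ _ hN ?_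
  rw [tendsto_pi_nhds]
  intro ω
  obtain ⟨K, hK⟩ := Sm_eq_sum hT m ω
  refine tendsto_const_nhds.congr' ?_
  filter_upwards [eventually_ge_atTop K] with N hN
  rw [hK N hN t ht.2]
  refine Finset.sum_congr rfl fun k _ => ?_
  rcases le_total t (sig T hT m k ω) with h | h
  · rw [Sm_term_zero hT m k t ω h, mul_zero, mul_zero]
  · rw [min_eq_left h]

lemma qvRaw_meas {t : ℝ} (ht : t ∈ Set.Icc (0:ℝ) T) :
    Measurable[Fraw T t] (fun ω : Path T => qvRaw T hT ω t) := by
  have h1 : Measurable[Fraw T t] (fun ω : Path T => SS T hT t ω) :=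
    Measurable.liminf (fun m => Sm_meas hT m ht)
  have h2 := ev_meas hT ht.1 t le_rfl
  have h3 := ev_meas hT ht.1 0 ht.1
  exact ((h2.pow_const 2).sub (h3.pow_const 2)).sub (h1.const_mul 2)
lemma Fplus_iff {t : ℝ} {A : Set (Path T)} :
    MeasurableSet[Fplus T t] A ↔ ∀ s, t < s → MeasurableSet[Fraw T (min s T)] A := by
  exact MeasurableSpace.measurableSet_iInf.trans
    (forall_congr' fun s => MeasurableSpace.measurableSet_iInf)

lemma FbarPlus_iff {t : ℝ} {A : Set (PathPair T)} :
    MeasurableSet[FbarPlus T t] A ↔ ∀ s, t < s → MeasurableSet[FbarRaw T (min s T)] A := by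
  exact MeasurableSpace.measurableSet_iInf.trans
    (forall_congr' fun s => MeasurableSpace.measurableSet_iInf)

lemma Fplus_le {t s : ℝ} (h : t < s) : Fplus T t ≤ Fraw T (min s T) :=
  fun _ hA => Fplus_iff.1 hA s h

lemma Fplus_mono {s t : ℝ} (h : s ≤ t) : Fplus T s ≤ Fplus T t :=
  fun _ hA => Fplus_iff.2 fun r hr => Fplus_iff.1 hA r (h.trans_lt hr)

lemma fst_meas_raw (t : ℝ) : Measurable[FbarRaw T t, Fraw T t] (Prod.fst : PathPair T → Path T) := by
  rw [measurable_iff_comap_le, Fraw, MeasurableSpace.comap_iSup]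
  refine iSup_le fun s => ?_
  rw [MeasurableSpace.comap_iSup]
  refine iSup_le fun hs => ?_
  rw [MeasurableSpace.comap_comp]
  refine le_trans ?_ (le_iSup_of_le s (le_iSup_of_le hs le_rfl))
  have : ((fun ω : Path T => ω s) ∘ (Prod.fst : PathPair T → Path T))
    = Prod.fst ∘ (fun p : PathPair T => (p.1 s, p.2 s)) := rfl
  rw [this, ← MeasurableSpace.comap_comp]
  exact MeasurableSpace.comap_mono measurable_fst.comap_le

lemma fst_meas (t : ℝ) :
    Measurable[FbarDeltaPlus T hT t, Fplus T t] (Prod.fst : PathPair T → Path T) := by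
  intro A hA
  have h : FbarPlus T t ≤ FbarDeltaPlus T hT t := le_sup_left
  refine h _ (FbarPlus_iff.2 fun s hs => ?_)
  exact fst_meas_raw (min s T) (Fplus_iff.1 hA s hs)

lemma psi_meas_raw {t : ℝ} :
    Measurable[MeasurableSpace.comap ((↑) : BigOmega T hT → Path T) (Fraw T t), FbarRaw T t]
      (fun ω : BigOmega T hT => psiMap T hT ω) := by
  rw [measurable_iff_comap_le, FbarRaw, MeasurableSpace.comap_iSup]
  refine iSup_le fun s => ?_
  rw [MeasurableSpace.comap_iSup]
  refine iSup_le fun hs => ?_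
  rw [MeasurableSpace.comap_comp, ← measurable_iff_comap_le]
  have e : ((fun p : PathPair T => (p.1 s, p.2 s)) ∘ fun ω : BigOmega T hT => psiMap T hT ω)
    = (fun ω : Path T => (ω s, qvRaw T hT ω s)) ∘ ((↑) : BigOmega T hT → Path T) := by
    funext ω
    simp only [Function.comp, psiMap, qv_apply hT ω.2]
  rw [e]
  have h1 : Measurable[Fraw T t] (fun ω : Path T => (ω s, qvRaw T hT ω s)) :=
    (eval_meas s hs).prodMk ((qvRaw_meas hT s.2).mono (Fraw_mono hs) le_rfl)
  exact h1.comp (comap_measurable _)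

lemma psi_meas {t : ℝ} :
    Measurable[MeasurableSpace.comap ((↑) : BigOmega T hT → Path T) (Fplus T t),
      FbarDeltaPlus T hT t] (fun ω : BigOmega T hT => psiMap T hT ω) := by
  rw [measurable_iff_le_map, FbarDeltaPlus]
  refine sup_le ?_ ?_
  · intro A hA
    have hB : ∀ n : ℕ, ∃ B : Set (Path T), MeasurableSet[Fraw T (min (t + 1 / ((n:ℝ)+1)) T)] B ∧
        ((↑) : BigOmega T hT → Path T) ⁻¹' B = (fun ω : BigOmega T hT => psiMap T hT ω) ⁻¹' A := by
      intro n
      have hpos : (0:ℝ) < 1 / ((n:ℝ)+1) := by positivity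
      exact psi_meas_raw hT (FbarPlus_iff.1 hA (t + 1 / ((n:ℝ)+1)) (by linarith))
    choose B hBm hBe using hB
    refine ⟨⋂ n, ⋃ k, B (n + k), ?_, ?_⟩
    · rw [Fplus_iff]
      intro s hs
      obtain ⟨N, hN⟩ := exists_nat_one_div_lt (sub_pos.2 hs)
      have e : ⋂ n, ⋃ k, B (n + k) = ⋂ n, ⋃ k, B (N + n + k) := by
        ext ω
        simp only [mem_iInter, mem_iUnion]
        constructor
        · intro h n; exact h (N + n)
        · intro h n
          obtain ⟨k, hk⟩ := h n
          exact ⟨N + k, by convert hk using 2; ring⟩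
      rw [e]
      refine @MeasurableSet.iInter _ _ (_) _ _ fun n => 
        @MeasurableSet.iUnion _ _ (_) _ _ fun k => ?_
      refine Fraw_mono (min_le_min_right _ ?_) _ (hBm (N + n + k))
      have : (1:ℝ) / (((N + n + k : ℕ):ℝ)+1) ≤ 1 / ((N:ℝ)+1) := by
        apply one_div_le_one_div_of_le (by positivity)
        push_cast
        have : (0:ℝ) ≤ n := by positivity
        have : (0:ℝ) ≤ k := by positivity
        linarith
      linarith
    · simp only [preimage_iInter, preimage_iUnion, hBe, iInter_const, iUnion_const]
  · refine MeasurableSpace.generateFrom_le ?_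
    intro N hN
    refine ⟨∅, @MeasurableSet.empty _ (_), ?_⟩
    rw [preimage_empty]
    ext ω
    simp only [mem_empty_iff_false, mem_preimage, false_iff]
    exact fun h => hN h ⟨ω, ω.2, rfl⟩

lemma stop_ext (τb : PathPair T → ℝ) (h0 : ∀ p, 0 ≤ τb p) (h1 : ∀ p, τb p ≤ T)
    (hs : IsStopBarDeltaPlus T hT τb) :
    ∃ τ : Path T → ℝ, (∀ ω, 0 ≤ τ ω) ∧ (∀ ω, τ ω ≤ T) ∧ IsStopPlus T τ ∧
      ∀ ω ∈ BigOmega T hT, τ ω = τb (psiMap T hT ω) := by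
  have hB : ∀ t : ℝ, t ∈ Set.Icc (0:ℝ) T → ∃ B : Set (Path T), MeasurableSet[Fplus T t] B ∧
      ((↑) : BigOmega T hT → Path T) ⁻¹' B =
        (fun ω : BigOmega T hT => psiMap T hT ω) ⁻¹' {p | τb p ≤ t} := by
    intro t ht
    exact psi_meas hT (hs t ht)
  choose! B hBm hBe using hB
  have hBe' : ∀ t ∈ Set.Icc (0:ℝ) T, ∀ ω ∈ BigOmega T hT, ω ∈ B t ↔ τb (psiMap T hT ω) ≤ t := by
    intro t ht ω hω
    exact Set.ext_iff.1 (hBe t ht) ⟨ω, hω⟩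
  let D : Path T → Set ℝ := fun ω => {q | q ∈ Set.Icc (0:ℝ) T ∧ (∃ r : ℚ, (r:ℝ) = q) ∧ ω ∈ B q} ∪ {T}
  have hDb : ∀ ω, BddBelow (D ω) := by
    intro ω
    refine ⟨0, ?_⟩
    rintro x (hx | hx)
    · exact hx.1.1
    · rw [hx]; exact hT
  have hDn : ∀ ω, (D ω).Nonempty := fun ω => ⟨T, Or.inr rfl⟩
  refine ⟨fun ω => sInf (D ω), ?_, ?_, ?_, ?_⟩
  · intro ω
    refine le_csInf (hDn ω) ?_
    rintro x (hx | hx)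
    · exact hx.1.1
    · rw [hx]; exact hT
  · exact fun ω => csInf_le (hDb ω) (Or.inr rfl)
  · intro c hc
    rw [Fplus_iff]
    intro s hs
    rcases hc.2.eq_or_lt with h | h
    · have e : {ω | sInf (D ω) ≤ c} = univ := by
        ext ω
        simp only [mem_ofPred_eq, mem_univ, iff_true]
        exact h ▸ csInf_le (hDb ω) (Or.inr rfl)
      rw [e]
      exact @MeasurableSet.univ _ (_)
    · have hs' : 0 < min s T - c := sub_pos.2 (lt_min hs h)
      have e : {ω | sInf (D ω) ≤ c} = ⋂ n : ℕ, ⋃ r : ℚ, 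
          {ω | ((r:ℝ) ∈ Set.Icc (0:ℝ) T ∧ (r:ℝ) < c + (min s T - c) / ((n:ℝ)+1)) ∧ ω ∈ B r} := by
        ext ω
        simp only [mem_iInter, mem_iUnion, mem_ofPred_eq]
        constructor
        · intro hle n
          have hp : 0 < (min s T - c) / ((n:ℝ)+1) := by positivity
          have hp2 : (min s T - c) / ((n:ℝ)+1) ≤ min s T - c :=
            div_le_self hs'.le (by have : (0:ℝ) ≤ n := by positivity
                                   linarith)
          obtain ⟨q, hq, hlt⟩ := exists_lt_of_csInf_lt (hDn ω)
            (show sInf (D ω) < c + (min s T - c) / ((n:ℝ)+1) by linarith)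
          rcases hq with ⟨hq1, ⟨r, rfl⟩, hq3⟩ | hq
          · exact ⟨r, ⟨hq1, hlt⟩, hq3⟩
          · rw [mem_singleton_iff] at hq
            have := min_le_right s T
            linarith
        · intro hn
          have hlim : Tendsto (fun n : ℕ => c + (min s T - c) / ((n:ℝ)+1)) atTop (𝓝 (c + 0)) := by
            refine tendsto_const_nhds.add ?_
            exact tendsto_const_nhds.div_atTop
              (tendsto_atTop_add_const_right _ _ tendsto_natCast_atTop_atTop)
          rw [add_zero] at hlim
          refine ge_of_tendsto' hlim fun n => ?_
          obtain ⟨r, ⟨hr1, hr2⟩, hr3⟩ := hn n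
          exact (csInf_le (hDb ω) (Or.inl ⟨hr1, ⟨r, rfl⟩, hr3⟩)).trans hr2.le
      rw [e]
      refine @MeasurableSet.iInter _ _ (_) _ _ fun n => 
        @MeasurableSet.iUnion _ _ (_) _ _ fun r => ?_
      by_cases hr : (r:ℝ) ∈ Set.Icc (0:ℝ) T ∧ (r:ℝ) < c + (min s T - c) / ((n:ℝ)+1)
      · simp only [hr, and_self, true_and]
        refine Fplus_le ?_ _ (hBm r hr.1)
        have hp2 : (min s T - c) / ((n:ℝ)+1) ≤ min s T - c :=
            div_le_self hs'.le (by have : (0:ℝ) ≤ n := by positivity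
                                   linarith)
        have := min_le_left s T
        linarith [hr.2]
      · simp only [hr, false_and]
        exact @MeasurableSet.empty _ (_)
  · intro ω hω
    apply le_antisymm
    · by_contra! hlt
      obtain ⟨r, hr1, hr2⟩ := exists_rat_btwn hlt
      have hrT : (r:ℝ) ≤ T := hr2.le.trans (csInf_le (hDb ω) (Or.inr rfl))
      have hr0 : 0 ≤ (r:ℝ) := (h0 _).trans hr1.le
      have := csInf_le (hDb ω) (Or.inl ⟨⟨hr0, hrT⟩, ⟨r, rfl⟩, (hBe' r ⟨hr0, hrT⟩ ω hω).2 hr1.le⟩)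
      linarith
    · refine le_csInf (hDn ω) ?_
      rintro x (hx | hx)
      · exact (hBe' x hx.1 ω hω).1 hx.2.2
      · rw [hx]; exact h1 _

lemma coeff_ext (τb hb : PathPair T → ℝ) (C : ℝ) (hC : ∀ p, |hb p| ≤ C)
    (hm : MeasAtStopBarDeltaPlus T hT τb hb) (τ : Path T → ℝ) (h0 : ∀ ω, 0 ≤ τ ω)
    (h1 : ∀ ω, τ ω ≤ T) (hs : IsStopPlus T τ) 
    (he : ∀ ω ∈ BigOmega T hT, τ ω = τb (psiMap T hT ω)) :
    ∃ h : Path T → ℝ, (∃ C, ∀ ω, |h ω| ≤ C) ∧ MeasAtStopPlus T τ h ∧ 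
      ∀ ω ∈ BigOmega T hT, h ω = hb (psiMap T hT ω) := by
  have hg : ∀ t : ℝ, t ∈ Set.Icc (0:ℝ) T → ∃ g : Path T → ℝ, Measurable[Fplus T t] g ∧
      (∀ ω, |g ω| ≤ C) ∧
      ∀ ω ∈ BigOmega T hT, τ ω ≤ t → g ω = hb (psiMap T hT ω) := by
    intro t ht
    have hst : MeasurableSet[FbarDeltaPlus T hT t] {p | τb p ≤ t} := by
      simpa using hm univ MeasurableSet.univ t ht
    have hind : Measurable[FbarDeltaPlus T hT t] (fun p => if τb p ≤ t then hb p else 0) := by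
      intro A hA
      have e : (fun p => if τb p ≤ t then hb p else 0) ⁻¹' A =
          (hb ⁻¹' A ∩ {p | τb p ≤ t}) ∪ ({p | (0:ℝ) ∈ A} ∩ {p | τb p ≤ t}ᶜ) := by
        ext p
        by_cases hp : τb p ≤ t <;> simp [hp]
      rw [e]
      exact @MeasurableSet.union _ (_) _ _ (hm A hA t ht) (@MeasurableSet.inter _ (_) _ _
        (@MeasurableSet.const _ (_) _) (@MeasurableSet.compl _ _ (_) hst))
    have := hind.comp (psi_meas hT)
    obtain ⟨g, hgm, hge⟩ := @Measurable.exists_eq_measurable_comp _ _ _ (Fplus T t) _ _ _ _ _ this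
    have hC0 : 0 ≤ C := (abs_nonneg _).trans (hC (0, 0))
    refine ⟨fun ω => max (-C) (min C (g ω)), ?_, ?_, ?_⟩
    · exact (@measurable_const _ _ _ (Fplus T t) (-C)).max
        ((@measurable_const _ _ _ (Fplus T t) C).min hgm)
    · intro ω
      rw [abs_le]
      exact ⟨le_max_left _ _, max_le (by linarith) (min_le_left _ _)⟩
    · intro ω hω hle
      have h2 := congrFun hge ⟨ω, hω⟩
      simp only [Function.comp, ← he ω hω, hle, if_true] at h2
      show max (-C) (min C (g ω)) = _
      rw [← h2]
      have := abs_le.1 (hC (psiMap T hT ω))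
      rw [min_eq_right this.2, max_eq_right this.1]
  choose! g hgm hgC hge using hg
  let r : ℕ → ℕ → ℝ := fun n k => min T (((k:ℝ) + 1) / ((n:ℝ)+1))
  have hr : ∀ n k, r n k ∈ Set.Icc (0:ℝ) T := fun n k => ⟨le_min hT (by positivity), min_le_left _ _⟩
  let F : ℕ → Path T → ℝ := fun n ω => g (r n ⌊((n:ℝ)+1) * τ ω⌋₊) ω
  have hFC : ∀ n ω, |F n ω| ≤ C := fun n ω => hgC _ (hr _ _) ω
  have hlow : ∀ ω, IsBoundedUnder (· ≥ ·) atTop (fun n => F n ω) := fun ω =>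
    isBoundedUnder_of ⟨-C, fun n => (abs_le.1 (hFC n ω)).1⟩
  have hup : ∀ ω, IsBoundedUnder (· ≤ ·) atTop (fun n => F n ω) := fun ω =>
    isBoundedUnder_of ⟨C, fun n => (abs_le.1 (hFC n ω)).2⟩
  refine ⟨fun ω => limsup (fun n => F n ω) atTop, ⟨C, fun ω => ?_⟩, ?_, ?_⟩
  · rw [abs_le]
    constructor
    · exact le_limsup_of_frequently_le (Frequently.of_forall fun n => (abs_le.1 (hFC n ω)).1) (hup ω)
    · exact limsup_le_of_le (hlow ω).isCoboundedUnder_le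
        (Eventually.of_forall fun n => (abs_le.1 (hFC n ω)).2)
  · intro A hA t ht
    rw [Fplus_iff]
    intro s hs'
    have hst : MeasurableSet[Fraw T (min s T)] {ω | τ ω ≤ t} := Fplus_le hs' _ (hs t ht)
    have hτm : Measurable[Fraw T (min s T)] (fun ω => min (τ ω) t) := by
      refine measurable_of_Iic fun c => ?_
      by_cases hc : t ≤ c
      · convert @MeasurableSet.univ _ (Fraw T (min s T))
        ext ω; simp [hc]
      · push Not at hc
        by_cases h : 0 ≤ c
        · have := Fplus_le (hc.trans hs') _ (hs c ⟨h, hc.le.trans ht.2⟩)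
          convert this using 1
          ext ω; simp [not_le.2 hc]
        · convert @MeasurableSet.empty _ (Fraw T (min s T))
          ext ω
          simp only [mem_preimage, mem_Iic, mem_empty_iff_false, iff_false, min_le_iff, not_or, not_le]
          exact ⟨(not_le.1 h).trans_le (h0 ω), hc⟩
    obtain ⟨N, hN⟩ := exists_nat_one_div_lt (sub_pos.2 hs')
    have hFm : ∀ n, Measurable[Fraw T (min s T)]
        (fun ω => if τ ω ≤ t then F (n + N) ω else 0) := by
      intro n
      have hfl : Measurable[Fraw T (min s T)]
          (fun ω => ⌊(((n + N : ℕ):ℝ)+1) * min (τ ω) t⌋₊) :=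
        Nat.measurable_floor.comp (hτm.const_mul _)
      have hG := meas_countable (fun k ω => if r (n + N) k < s then g (r (n+N) k) ω else 0)
        (fun k => by
          by_cases hk : r (n + N) k < s
          · simp only [hk, if_true]
            exact (hgm _ (hr _ _)).mono (Fplus_le hk) le_rfl
          · simp only [hk, if_false]
            exact @measurable_const _ _ _ (Fraw T (min s T)) _) _ hfl
      have := @Measurable.ite _ _ _ _ (Fraw T (min s T)) _ (fun a => τ a ≤ t) (fun a => inferInstance) hst hG
        (@measurable_const _ _ _ (Fraw T (min s T)) 0)
      convert this using 2 with ω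
      by_cases hω : τ ω ≤ t
      · simp only [hω, if_true, min_eq_left]
        rw [if_pos]
        refine (min_le_right _ _).trans_lt ?_
        have hp : (0:ℝ) < ((n + N : ℕ):ℝ) + 1 := by positivity
        have hfl := Nat.floor_le (mul_nonneg hp.le (h0 ω))
        have h3 : (1:ℝ) / (((n + N : ℕ):ℝ)+1) ≤ 1 / ((N:ℝ)+1) := by
          apply one_div_le_one_div_of_le (by positivity)
          push_cast
          have : (0:ℝ) ≤ n := by positivity
          linarith
        rw [add_div]
        have h4 : (⌊(((n + N : ℕ):ℝ) + 1) * τ ω⌋₊ : ℝ) / (((n + N : ℕ):ℝ)+1) ≤ τ ω := by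
          rw [div_le_iff₀ hp]; linarith
        linarith
      · simp only [hω, if_false]
    have hlim := Measurable.limsup hFm
    have e : (fun ω => limsup (fun n => F n ω) atTop) ⁻¹' A ∩ {ω | τ ω ≤ t} =
        (fun ω => limsup (fun n => if τ ω ≤ t then F (n + N) ω else 0) atTop) ⁻¹' A
          ∩ {ω | τ ω ≤ t} := by
      ext ω
      simp only [mem_inter_iff, mem_preimage, mem_ofPred_eq]
      refine and_congr_left fun hω => ?_
      simp only [hω, if_true]
      rw [limsup_nat_add (fun n => F n ω) N]
    rw [e]
    exact @MeasurableSet.inter _ (_) _ _ (hlim hA) hst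
  · intro ω hω
    have : (fun n => F n ω) = fun _ => hb (psiMap T hT ω) := by
      funext n
      refine hge _ (hr _ _) ω hω (le_min (h1 ω) ?_)
      have hp : (0:ℝ) < (n:ℝ) + 1 := by positivity
      rw [le_div_iff₀ hp]
      have := Nat.lt_floor_add_one (((n:ℝ)+1) * τ ω)
      linarith
    simp only [this, limsup_const]
lemma fwd (Hs : SimpleStrategy T) : ∃ Hb : SimpleStrategyBar T hT,
    ∀ (X : ℝ → Path T → ℝ) (Xb : ℝ → PathPair T → ℝ), ∀ t ∈ Set.Icc (0:ℝ) T, ∀ p : PathPair T,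
      (∀ u ∈ Set.Icc (0:ℝ) T, Xb u p = X u p.1) → integBar T hT Hb Xb t p = integ T Hs X t p.1 := by
  refine ⟨⟨Hs.L, fun l p => Hs.τ l p.1, fun l p => Hs.coeff l p.1, fun p => Hs.τ_nonneg p.1,
    fun l p => Hs.τ_mono l p.1, fun p => Hs.τ_le p.1, ?_, ?_, ?_⟩, ?_⟩
  · intro l t ht
    exact fst_meas hT t (Hs.τ_stop l t ht)
  · intro l
    obtain ⟨C, hC⟩ := Hs.coeff_bdd l
    exact ⟨C, fun p => hC p.1⟩
  · intro l B hB t ht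
    exact fst_meas hT t (Hs.coeff_meas l B hB t ht)
  · intro X Xb t ht p hX
    have hn : ∀ l, 0 ≤ Hs.τ l p.1 := by
      intro l
      induction l using Fin.induction with
      | zero => exact Hs.τ_nonneg _
      | succ l ih => exact ih.trans (Hs.τ_mono l _)
    have hm : ∀ l, min (Hs.τ l p.1) t ∈ Set.Icc (0:ℝ) T :=
      fun l => ⟨le_min (hn l) ht.1, (min_le_right _ _).trans ht.2⟩
    simp only [integBar, integ, hX _ (hm _)]

lemma bwd (Hb : SimpleStrategyBar T hT) : ∃ H : SimpleStrategy T,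
    ∀ (X : ℝ → Path T → ℝ) (Xb : ℝ → PathPair T → ℝ), ∀ t ∈ Set.Icc (0:ℝ) T,
      ∀ ω ∈ BigOmega T hT,
      (∀ u ∈ Set.Icc (0:ℝ) T, Xb u (psiMap T hT ω) = X u ω) →
      integ T H X t ω = integBar T hT Hb Xb t (psiMap T hT ω) := by
  have hmono : ∀ p, Monotone (fun l => Hb.τ l p) := fun p =>
    Fin.monotone_iff_le_succ.2 fun l => Hb.τ_mono l p
  have hn : ∀ l p, 0 ≤ Hb.τ l p := fun l p => (Hb.τ_nonneg p).trans (hmono p (Fin.zero_le l))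
  have hle : ∀ l p, Hb.τ l p ≤ T := fun l p => (hmono p (Fin.le_last l)).trans (Hb.τ_le p)
  choose σ hσ0 hσT hσs hσe using fun l => stop_ext hT (Hb.τ l) (hn l) (hle l) (Hb.τ_stop l)
  let τ : Fin (Hb.L + 1) → Path T → ℝ := fun l ω =>
    (Finset.Iic l).sup' ⟨l, Finset.mem_Iic.2 le_rfl⟩ (fun j => σ j ω)
  have hτ0 : ∀ l ω, 0 ≤ τ l ω := fun l ω =>
    (hσ0 l ω).trans (Finset.le_sup' (fun j => σ j ω) (Finset.mem_Iic.2 le_rfl))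
  have hτT : ∀ l ω, τ l ω ≤ T := fun l ω => Finset.sup'_le _ _ fun j _ => hσT j ω
  have hτs : ∀ l, IsStopPlus T (τ l) := by
    intro l t ht
    have e : {ω | τ l ω ≤ t} = ⋂ j ∈ Finset.Iic l, {ω | σ j ω ≤ t} := by
      ext ω
      simp only [mem_iInter]
      exact Finset.sup'_le_iff (⟨l, Finset.mem_Iic.2 le_rfl⟩ : (Finset.Iic l).Nonempty) (fun j => σ j ω)
    rw [e]
    exact Finset.measurableSet_biInter _ fun j _ => hσs j t ht
  have hτe : ∀ l, ∀ ω ∈ BigOmega T hT, τ l ω = Hb.τ l (psiMap T hT ω) := by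
    intro l ω hω
    apply le_antisymm
    · refine Finset.sup'_le _ _ fun j hj => ?_
      rw [hσe j ω hω]
      exact hmono _ (Finset.mem_Iic.1 hj)
    · rw [← hσe l ω hω]
      exact Finset.le_sup' (fun j => σ j ω) (Finset.mem_Iic.2 le_rfl)
  choose C hC using Hb.coeff_bdd
  choose h hhb hhm hhe using fun l : Fin Hb.L => coeff_ext hT (Hb.τ l.castSucc) (Hb.coeff l) (C l) (hC l)
    (Hb.coeff_meas l) (τ l.castSucc) (hτ0 _) (hτT _) (hτs _) (hτe _)
  refine ⟨⟨Hb.L, τ, h, hτ0 0, ?_, hτT _, hτs, hhb, hhm⟩, ?_⟩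
  · intro l ω
    exact Finset.sup'_mono (fun j => σ j ω) (Finset.Iic_subset_Iic.2 (Fin.castSucc_le_succ l)) _
  · intro X Xb t ht ω hω hX
    have hm : ∀ l, min (Hb.τ l (psiMap T hT ω)) t ∈ Set.Icc (0:ℝ) T :=
      fun l => ⟨le_min (hn l _) ht.1, (min_le_right _ _).trans ht.2⟩
    simp only [integBar, integ, hX _ (hm _), hτe _ ω hω, hhe _ ω hω]

end aux

/-- **Lemma 4.4 (transfer of pathwise integrals).** Simple strategies on `Ω` can be
lifted to the enlarged space so that the integrals agree on `Δ̄`, and conversely simple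
strategies on the enlarged space can be pushed down to `Ω` so that the integrals agree
along `ψ`. -/
theorem integral_transfer (T : ℝ) (hT : 0 ≤ T) :
    (∀ H G : SimpleStrategy T, ∃ Hbar Gbar : SimpleStrategyBar T hT,
      ∀ t ∈ Set.Icc (0:ℝ) T, ∀ p ∈ Delta T hT,
        integBar T hT Hbar (SbarProc T hT) t p + integBar T hT Gbar (SSbarProc T hT) t p
          = integ T H (Sproc T hT) t p.1 + integ T G (SS T hT) t p.1) ∧
    (∀ Hbar Gbar : SimpleStrategyBar T hT, ∃ H G : SimpleStrategy T,
      ∀ t ∈ Set.Icc (0:ℝ) T, ∀ ω ∈ BigOmega T hT,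
        integ T H (Sproc T hT) t ω + integ T G (SS T hT) t ω
          = integBar T hT Hbar (SbarProc T hT) t (psiMap T hT ω)
            + integBar T hT Gbar (SSbarProc T hT) t (psiMap T hT ω)) := by
  refine ⟨fun H G => ?_, fun Hb Gb => ?_⟩
  · obtain ⟨Hb, hH⟩ := fwd hT H
    obtain ⟨Gb, hG⟩ := fwd hT G
    refine ⟨Hb, Gb, ?_⟩
    rintro t ht _ ⟨ω, hω, rfl⟩
    rw [hH (Sproc T hT) (SbarProc T hT) t ht _ (fun u _ => rfl),
      hG (SS T hT) (SSbarProc T hT) t ht _ (fun u hu => SSbar_psi hT hω hu)]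
  · obtain ⟨H, hH⟩ := bwd hT Hb
    obtain ⟨G, hG⟩ := bwd hT Gb
    refine ⟨H, G, ?_⟩
    intro t ht ω hω
    rw [hH (Sproc T hT) (SbarProc T hT) t ht ω hω (fun u _ => rfl),
      hG (SS T hT) (SSbarProc T hT) t ht ω hω (fun u hu => SSbar_psi hT hω hu)]

end PathwiseSuperhedging
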